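/- For every w ∈ F there exists a natural number k such that the element (b⁴)^w belongs to dom(ψ^{∘k}) and ψ^{∘k}((b⁴)^w) = 1. -/

import Mathlib

/-- F is the free group on two generators a and b. -/
abbrev F : Type := FreeGroup Bool

def a : F := FreeGroup.of false
def b : F := FreeGroup.of true

/-- The homomorphism F → ℤ/2ℤ sending a ↦ 1 and b ↦ 0. -/
def toZ2 : F →* Multiplicative (ZMod 2) :=
  FreeGroup.lift fun s => Multiplicative.ofAdd (if s then (0 : ZMod 2) else 1)

/-- H is the kernel: the elements whose total exponent sum in a is even. -/
def H : Subgroup F := toZ2.ker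

/-- g ∈ dom(ψ^{∘k}): dom(ψ^{∘0}) = F and dom(ψ^{∘(k+1)}) = {g ∈ H : ψ(g) ∈ dom(ψ^{∘k})}. -/
def inDom (ψ : H →* F) : ℕ → F → Prop
  | 0, _ => True
  | k + 1, g => ∃ h : g ∈ H, inDom ψ k (ψ ⟨g, h⟩)

open scoped Classical in
/-- The iterate ψ^{∘k}: ψ^{∘0} = id and ψ^{∘(k+1)}(g) = ψ^{∘k}(ψ(g))
(with junk value 1 outside the domain). -/
noncomputable def iterPsi (ψ : H →* F) : ℕ → F → F
  | 0, g => g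
  | k + 1, g => if h : g ∈ H then iterPsi ψ k (ψ ⟨g, h⟩) else 1

/-- `BLength n w`: the element `w` can be written as a word in `a`, `b` and their inverses
with at most `n` occurrences of `b` and `b⁻¹`. -/
inductive BLength : ℕ → F → Prop
  | zpow (n : ℕ) (i : ℤ) : BLength n (a ^ i)
  | step {n : ℕ} {u : F} (i : ℤ) (hu : BLength n u) : BLength (n + 1) (a ^ i * b * u)
  | step_inv {n : ℕ} {u : F} (i : ℤ) (hu : BLength n u) : BLength (n + 1) (a ^ i * b⁻¹ * u)

namespace BLength

lemma zpow_mul {n : ℕ} {w : F} (hw : BLength n w) (j : ℤ) : BLength n (a ^ j * w) := by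
  cases hw with
  | zpow n i => rw [← zpow_add]; exact .zpow n _
  | step i hu => simpa [zpow_add, mul_assoc] using BLength.step (j + i) hu
  | step_inv i hu => simpa [zpow_add, mul_assoc] using BLength.step_inv (j + i) hu

lemma b_mul {n : ℕ} {w : F} (hw : BLength n w) : BLength (n + 1) (b * w) := by
  simpa using BLength.step 0 hw

lemma b_inv_mul {n : ℕ} {w : F} (hw : BLength n w) : BLength (n + 1) (b⁻¹ * w) := by
  simpa using BLength.step_inv 0 hw

lemma a_mul {n : ℕ} {w : F} (hw : BLength n w) : BLength n (a * w) := by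
  simpa using hw.zpow_mul 1

lemma a_inv_mul {n : ℕ} {w : F} (hw : BLength n w) : BLength n (a⁻¹ * w) := by
  simpa using hw.zpow_mul (-1)

lemma exists_mul (w : F) : ∀ u : F, (∃ n, BLength n u) → ∃ n, BLength n (w * u) := by
  induction w using FreeGroup.induction_on with
  | C1 => simp
  | of s =>
    rintro u ⟨n, hu⟩
    cases s
    · exact ⟨n, hu.a_mul⟩
    · exact ⟨n + 1, hu.b_mul⟩
  | inv_of s _ =>
    rintro u ⟨n, hu⟩
    cases s
    · exact ⟨n, hu.a_inv_mul⟩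
    · exact ⟨n + 1, hu.b_inv_mul⟩
  | mul x y hx hy =>
    intro u hu
    rw [mul_assoc]
    exact hx _ (hy _ hu)

lemma exists_blength (w : F) : ∃ n, BLength n w := by
  simpa using exists_mul w 1 ⟨0, by simpa using BLength.zpow 0 0⟩

end BLength

lemma toZ2_a : toZ2 a = Multiplicative.ofAdd 1 := by simp [toZ2, a]

lemma toZ2_b : toZ2 b = 1 := by simp [toZ2, b]

/-- The element `a²` of `H`. -/
def aSqH : H := ⟨a ^ 2, by rw [H, MonoidHom.mem_ker, map_pow, toZ2_a]; decide⟩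

/-- The element `b` of `H`. -/
def bH : H := ⟨b, toZ2_b⟩

/-- The element `a⁻¹ba` of `H`. -/
def cH : H := ⟨a⁻¹ * b * a, by simp [H, MonoidHom.mem_ker, toZ2_b]⟩

@[simp] lemma coe_aSqH : (aSqH : F) = a ^ 2 := rfl

@[simp] lemma coe_bH : (bH : F) = b := rfl

@[simp] lemma coe_cH : (cH : F) = a⁻¹ * b * a := rfl

lemma exists_eq_coe_or_eq_a_mul (w : F) : (∃ h : H, w = h) ∨ ∃ h : H, w = a * h := by
  have key : ∀ x : Multiplicative (ZMod 2), x = 1 ∨ (Multiplicative.ofAdd 1)⁻¹ * x = 1 := by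
    decide
  rcases key (toZ2 w) with h | h
  · exact .inl ⟨⟨w, h⟩, rfl⟩
  · refine .inr ⟨⟨a⁻¹ * w, ?_⟩, by simp⟩
    rw [H, MonoidHom.mem_ker, map_mul, map_inv, toZ2_a, h]

/-- Some iterate of `ψ` is defined at `g` and sends it to `1`. -/
def EventuallyTrivial (ψ : H →* F) (g : F) : Prop :=
  ∃ k : ℕ, inDom ψ k g ∧ iterPsi ψ k g = 1

namespace EventuallyTrivial

variable {ψ : H →* F}

lemma one : EventuallyTrivial ψ 1 := ⟨0, trivial, rfl⟩

lemma of_map {g v : F} (h : H) (hg : g = h) (hv : ψ h = v) (hψ : EventuallyTrivial ψ v) :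
    EventuallyTrivial ψ g := by
  subst hg hv
  obtain ⟨k, hk, hk'⟩ := hψ
  exact ⟨k + 1, ⟨h.2, hk⟩, by simpa [iterPsi] using hk'⟩

lemma conj_a_sq (ha : ψ aSqH = 1) (w : F) : EventuallyTrivial ψ (w⁻¹ * a ^ 2 * w) := by
  rcases exists_eq_coe_or_eq_a_mul w with ⟨h, rfl⟩ | ⟨h, rfl⟩
  · exact of_map (h⁻¹ * aSqH * h) (by simp) (by simp [ha]) one
  · refine of_map (h⁻¹ * aSqH * h) ?_ (by simp [ha]) one
    simp only [Subgroup.coe_mul, Subgroup.coe_inv, coe_aSqH]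
    group

lemma conj_ab_pow_four (ha : ψ aSqH = 1) (hb : ψ bH = b⁻¹ * a⁻¹) (hc : ψ cH = b) (w : F) :
    EventuallyTrivial ψ (w⁻¹ * (b⁻¹ * a⁻¹) ^ 4 * w) := by
  rcases exists_eq_coe_or_eq_a_mul w with ⟨h, rfl⟩ | ⟨h, rfl⟩
  · refine of_map (h⁻¹ * (bH⁻¹ * cH⁻¹ * aSqH⁻¹) ^ 2 * h) ?_ ?_ (conj_a_sq ha (ψ h))
    · simp only [Subgroup.coe_mul, Subgroup.coe_inv, Subgroup.coe_one, coe_aSqH, coe_bH, coe_cH,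
        pow_succ, pow_zero]
      group
    · simp [ha, hb, hc]
  · refine of_map (h⁻¹ * (cH⁻¹ * aSqH⁻¹ * bH⁻¹) ^ 2 * h) ?_ ?_ (conj_a_sq ha (b * ψ h))
    · simp only [Subgroup.coe_mul, Subgroup.coe_inv, Subgroup.coe_one, coe_aSqH, coe_bH, coe_cH,
        pow_succ, pow_zero]
      group
    · simp only [map_mul, map_inv, map_one, ha, hb, hc, pow_succ, pow_zero]
      group

lemma conj_b_of_mem (ha : ψ aSqH = 1) (hb : ψ bH = b⁻¹ * a⁻¹) (hc : ψ cH = b) (h : H) :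
    EventuallyTrivial ψ ((h : F)⁻¹ * b ^ 4 * h) :=
  of_map (h⁻¹ * bH ^ 4 * h) (by simp) (by simp [hb]) (conj_ab_pow_four ha hb hc (ψ h))

lemma conj_b_a_mul (hc : ψ cH = b) (h : H)
    (hψ : EventuallyTrivial ψ ((ψ h)⁻¹ * b ^ 4 * ψ h)) :
    EventuallyTrivial ψ ((a * h : F)⁻¹ * b ^ 4 * (a * h)) := by
  refine of_map (h⁻¹ * cH ^ 4 * h) ?_ (by simp [hc]) hψ
  simp only [Subgroup.coe_mul, Subgroup.coe_inv, Subgroup.coe_one, coe_cH, pow_succ, pow_zero]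
  group

lemma conj_b_b_zpow_mul {w : F} (i : ℤ) (hw : EventuallyTrivial ψ (w⁻¹ * b ^ 4 * w)) :
    EventuallyTrivial ψ ((b ^ i * w)⁻¹ * b ^ 4 * (b ^ i * w)) := by
  convert hw using 1
  group

end EventuallyTrivial

/-- Split off the leading letters of an element of `H` written as `a ^ k * b ^ e * u`. -/
lemma exists_factor_H {h : H} {k e : ℤ} {u : F} (hh : (h : F) = a ^ k * b ^ e * u) :
    (∃ (m : ℤ) (v : H), k = 2 * m ∧ (v : F) = u ∧ h = aSqH ^ m * bH ^ e * v) ∨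
    ∃ (m : ℤ) (v : H), k = 2 * m + 1 ∧ (v : F) = a * u ∧
      h = aSqH ^ (m + 1) * cH ^ e * aSqH⁻¹ * v := by
  have hsq : ∀ m : ℤ, ((aSqH ^ m : H) : F) = a ^ (2 * m) := fun m => by
    rw [Subgroup.coe_zpow, coe_aSqH, zpow_mul]; rfl
  have hb : ((bH ^ e : H) : F) = b ^ e := Subgroup.coe_zpow _ _ _
  have hc : ((cH ^ e : H) : F) = a⁻¹ * b ^ e * a := by
    rw [Subgroup.coe_zpow, coe_cH]
    simpa using conj_zpow (i := e) (a := a⁻¹) (b := b)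
  rcases Int.even_or_odd' k with ⟨m, rfl | rfl⟩
  · refine .inl ⟨m, (aSqH ^ m * bH ^ e)⁻¹ * h, rfl, ?_, by group⟩
    simp only [Subgroup.coe_mul, Subgroup.coe_inv, hsq, hh, hb]
    group
  · refine .inr ⟨m, (aSqH ^ (m + 1) * cH ^ e * aSqH⁻¹)⁻¹ * h, rfl, ?_, by group⟩
    simp only [Subgroup.coe_mul, Subgroup.coe_inv, hsq, hc, hh, coe_aSqH]
    group

section

variable {ψ : H →* F}

lemma map_eq_one_of_coe_eq_zpow (ha : ψ aSqH = 1) {h : H} {k : ℤ} (hh : (h : F) = a ^ k) :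
    ψ h = 1 := by
  rcases exists_factor_H (h := h) (k := k) (e := 0) (u := 1) (by simpa using hh) with
    ⟨m, v, -, hv, rfl⟩ | ⟨m, v, -, hv, -⟩
  · obtain rfl : v = 1 := Subtype.ext hv
    simp [ha]
  · have hv' : toZ2 v = 1 := v.2
    rw [hv, mul_one, toZ2_a] at hv'
    exact absurd hv' (by decide)

lemma BLength.map (ha : ψ aSqH = 1) (hb : ψ bH = b⁻¹ * a⁻¹) (hc : ψ cH = b) {n : ℕ} {w : F}
    (hw : BLength n w) : ∀ (j : ℤ) (h : H), (h : F) = a ^ j * w → BLength n (ψ h) := by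
  induction hw with
  | zpow n i =>
    intro j h hh
    rw [map_eq_one_of_coe_eq_zpow ha (hh.trans (zpow_add a j i).symm)]
    simpa using BLength.zpow n 0
  | @step _ u i _ ih =>
    intro j h hh
    rcases exists_factor_H (h := h) (k := j + i) (e := 1) (u := u) (by rw [hh]; group) with
      ⟨m, v, -, hv, rfl⟩ | ⟨m, v, -, hv, rfl⟩
    · simpa [ha, hb, mul_assoc] using (ih 0 v (by simpa using hv)).a_inv_mul.b_inv_mul
    · simpa [ha, hc] using (ih 1 v (by simpa using hv)).b_mul
  | @step_inv _ u i _ ih =>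
    intro j h hh
    rcases exists_factor_H (h := h) (k := j + i) (e := -1) (u := u) (by rw [hh]; group) with
      ⟨m, v, -, hv, rfl⟩ | ⟨m, v, -, hv, rfl⟩
    · simpa [ha, hb, mul_assoc] using (ih 0 v (by simpa using hv)).b_mul.a_mul
    · simpa [ha, hc] using (ih 1 v (by simpa using hv)).b_inv_mul

open EventuallyTrivial in
lemma eventuallyTrivial_conj_b (ha : ψ aSqH = 1) (hb : ψ bH = b⁻¹ * a⁻¹) (hc : ψ cH = b) (n : ℕ) :
    ∀ w : F, BLength n w → EventuallyTrivial ψ (w⁻¹ * b ^ 4 * w) := by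
  have of_zpow : ∀ i : ℤ, EventuallyTrivial ψ ((a ^ i)⁻¹ * b ^ 4 * a ^ i) := fun i => by
    rcases exists_eq_coe_or_eq_a_mul (a ^ i) with ⟨h, hi⟩ | ⟨h, hi⟩ <;> rw [hi]
    · exact conj_b_of_mem ha hb hc h
    · refine conj_b_a_mul hc h ?_
      have hh : (h : F) = a ^ (i - 1) := by
        rw [eq_inv_mul_of_mul_eq hi.symm]; group
      rw [map_eq_one_of_coe_eq_zpow ha hh]
      exact conj_b_of_mem ha hb hc 1
  induction n with
  | zero =>
    intro w hw
    cases hw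
    exact of_zpow _
  | succ n ih =>
    have of_b_inv_a_inv : ∀ v : F, BLength n v →
        EventuallyTrivial ψ ((b⁻¹ * (a⁻¹ * v))⁻¹ * b ^ 4 * (b⁻¹ * (a⁻¹ * v))) := fun v hv => by
      simpa using conj_b_b_zpow_mul (-1) (ih _ hv.a_inv_mul)
    have of_a_b : ∀ v : F, BLength n v →
        EventuallyTrivial ψ ((a * (b * v))⁻¹ * b ^ 4 * (a * (b * v))) := fun v hv => by
      rcases exists_eq_coe_or_eq_a_mul (a * (b * v)) with ⟨h, hi⟩ | ⟨h, hi⟩ <;> rw [hi]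
      · exact conj_b_of_mem ha hb hc h
      · refine conj_b_a_mul hc h ?_
        have hh : ((bH⁻¹ * h : H) : F) = a ^ (0 : ℤ) * v := by
          simp [← mul_left_cancel hi]
        have hψ : ψ h = b⁻¹ * (a⁻¹ * ψ (bH⁻¹ * h)) := by
          rw [map_mul, map_inv, hb]; group
        rw [hψ]
        exact of_b_inv_a_inv _ (hv.map ha hb hc 0 _ hh)
    intro w hw
    rcases exists_eq_coe_or_eq_a_mul w with ⟨h, rfl⟩ | ⟨h, rfl⟩
    · exact conj_b_of_mem ha hb hc h
    generalize hx : a * (h : F) = x at hw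
    cases hw with
    | zpow _ i => exact of_zpow i
    | @step _ u i hu =>
      rw [← hx]
      refine conj_b_a_mul hc h ?_
      rcases exists_factor_H (h := h) (k := i - 1) (e := 1) (u := u)
        (by rw [eq_inv_mul_of_mul_eq hx]; group) with ⟨m, v, -, hv, rfl⟩ | ⟨m, v, -, hv, rfl⟩
      · simpa [ha, hb, mul_assoc] using
          of_b_inv_a_inv _ (hu.map ha hb hc 0 v (by simpa using hv))
      · simpa [ha, hc] using
          conj_b_b_zpow_mul 1 (ih _ (hu.map ha hb hc 1 v (by simpa using hv)))
    | @step_inv _ u i hu =>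
      rw [← hx]
      refine conj_b_a_mul hc h ?_
      rcases exists_factor_H (h := h) (k := i - 1) (e := -1) (u := u)
        (by rw [eq_inv_mul_of_mul_eq hx]; group) with ⟨m, v, -, hv, rfl⟩ | ⟨m, v, -, hv, rfl⟩
      · simpa [ha, hb, mul_assoc] using
          of_a_b _ (hu.map ha hb hc 0 v (by simpa using hv))
      · simpa [ha, hc] using
          conj_b_b_zpow_mul (-1) (ih _ (hu.map ha hb hc 1 v (by simpa using hv)))

end

/-- For every w ∈ F there exists k ∈ ℕ with (b⁴)^w ∈ dom(ψ^{∘k}) and ψ^{∘k}((b⁴)^w) = 1. -/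
theorem stmt18 (ψ : H →* F)
    (hψa2 : ∀ u : H, (u : F) = a ^ 2 → ψ u = 1)
    (hψb : ∀ u : H, (u : F) = b → ψ u = b⁻¹ * a⁻¹)
    (hψc : ∀ u : H, (u : F) = a⁻¹ * b * a → ψ u = b)
    (w : F) :
    ∃ k : ℕ, inDom ψ k (w⁻¹ * b ^ 4 * w) ∧ iterPsi ψ k (w⁻¹ * b ^ 4 * w) = 1 := by
  obtain ⟨n, hn⟩ := BLength.exists_blength w
  exact eventuallyTrivial_conj_b (hψa2 aSqH rfl) (hψb bH rfl) (hψc cH rfl) n w hn
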